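/- arXiv:0810.1419 — 6 statements merged into one kernel-verified Lean document; each statement's English description precedes it below -/
import Mathlib

section
/- Energy balance for weak solutions (Theorem 2.5 of the paper). Let T > 0, let z : ℝ → Z be differentiable at every t ∈ [0,T] with derivative ż(t), and suppose z satisfies the dissipative Hamiltonian inclusion at every t ∈ [0,T] for a time-dependent Hamiltonian H : ℝ → Z → ℝ and a dissipation function R : Z → Z → ℝ. Assume additionally: (i) for every w ∈ Z, R(w,·) is positively 1-homogeneous, i.e. R(w, λ•v) = λ·R(w,v) for all λ ≥ 0 and v ∈ Z; (ii) R depends only on the first component of the rate, i.e. R(w,(a,b)) = R(w,(a,0)) for all w ∈ Z and a,b ∈ E; (iii) for every t ∈ [0,T], H admits a partial derivative in time ∂ₜH(t, w) at every w, and the map t ↦ H(t, z(t)) has at every t ∈ [0,T] the derivative ∂ₜH(t,z(t)) + ⟪∇₂H(t,z(t)), ż(t)⟫, this derivative being interval-integrable on [0,T]; (iv) the maps τ ↦ ∂ₜH(τ, z(τ)) and τ ↦ R(z(τ), ż(τ)) are interval-integrable on [0,T]. Then for every t ∈ [0,T]: H(0, z(0)) + ∫₀ᵗ ∂ₜH(τ,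 z(τ)) dτ = H(t, z(t)) + ∫₀ᵗ R(z(τ), ż(τ)) dτ. -/
open MeasureTheory intervalIntegral Set
open scoped RealInnerProductSpace

noncomputable def innerZ {E : Type*} [NormedAddCommGroup E] [InnerProductSpace ℝ E]
    (a b : E × E) : ℝ :=
  ⟪a.1, b.1⟫ + ⟪a.2, b.2⟫

noncomputable def sympl {E : Type*} [NormedAddCommGroup E] [InnerProductSpace ℝ E]
    (a b : E × E) : ℝ :=
  ⟪a.1, b.2⟫ - ⟪b.1, a.2⟫

/-- symplectic gradient associated to a gradient `g`. -/
def Xg {E : Type*} [NormedAddCommGroup E] (g : E × E) : E × E := (g.2, -g.1)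

/-- `F : E × E → ℝ` has gradient `g` (w.r.t. the product inner product) at `z`:
the Fréchet derivative of `F` at `z` is `⟪g, ·⟫`. -/
noncomputable def HasGradZAt {E : Type*} [NormedAddCommGroup E] [InnerProductSpace ℝ E]
    (F : E × E → ℝ) (g z : E × E) : Prop :=
  HasFDerivAt F
    (((innerSL ℝ g.1).comp (ContinuousLinearMap.fst ℝ E E)) +
      ((innerSL ℝ g.2).comp (ContinuousLinearMap.snd ℝ E E))) z

/-- dissipative Hamiltonian inclusion at a point: `R` dissipation, `zt` current state,
`zdot` rate, `gradH` gradient of the current Hamiltonian at the current state. -/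
def DissInclAt {E : Type*} [NormedAddCommGroup E] [InnerProductSpace ℝ E]
    (R : (E × E) → (E × E) → ℝ) (zt zdot gradH : E × E) : Prop :=
  ∀ z'' : E × E, R zt (zdot + z'') ≥ R zt zdot + sympl (zdot - Xg gradH) z''

/-- dissipation distance associated to a dissipation function `R`. -/
noncomputable def dissDist {V : Type*} [NormedAddCommGroup V] [NormedSpace ℝ V]
    (R : V → V → ℝ) (a b : V) : ENNReal :=
  sInf { c : ENNReal | ∃ γ γd : ℝ → V, γ 0 = a ∧ γ 1 = b ∧
    (∀ s ∈ Set.Icc (0:ℝ) 1, HasDerivAt γ (γd s) s) ∧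
    IntervalIntegrable (fun s => R (γ s) (γd s)) volume 0 1 ∧
    c = ENNReal.ofReal (∫ s in (0:ℝ)..1, R (γ s) (γd s)) }

/-- The dissipation of a positively homogeneous `R` along the inclusion is the power lost by the
Hamiltonian, as seen by testing the inclusion with the rate and its negative. -/
theorem DissInclAt.innerZ_eq_neg {E : Type*} [NormedAddCommGroup E] [InnerProductSpace ℝ E]
    {R : (E × E) → (E × E) → ℝ} {w v g : E × E}
    (hincl : DissInclAt R w v g) (hRzero : R w 0 = 0)
    (hhom : ∀ l : ℝ, 0 ≤ l → ∀ u : E × E, R w (l • u) = l * R w u) :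
    innerZ g v = -R w v := by
  have hadd := hincl v
  have hneg := hincl (-v)
  rw [← two_smul ℝ v, hhom 2 zero_le_two] at hadd
  rw [add_neg_cancel, hRzero] at hneg
  simp only [sympl, Xg, Prod.fst_sub, Prod.snd_sub, Prod.fst_neg, Prod.snd_neg, inner_sub_left,
    inner_sub_right, inner_neg_left, inner_neg_right] at hadd hneg
  rw [real_inner_comm g.1 v.1] at hadd hneg
  simp only [innerZ]
  linarith

/-- Energy balance for weak solutions (Theorem 2.5). -/
theorem energy_balance
    {E : Type*} [NormedAddCommGroup E] [InnerProductSpace ℝ E]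
    (T : ℝ) (hT : 0 < T)
    (z zdot : ℝ → E × E)
    (H : ℝ → E × E → ℝ) (gradH : ℝ → E × E → E × E) (Ht : ℝ → E × E → ℝ)
    (R : (E × E) → (E × E) → ℝ)
    (hRnonneg : ∀ w v : E × E, 0 ≤ R w v)
    (hRzero : ∀ w : E × E, R w 0 = 0)
    (hderiv : ∀ t ∈ Icc (0:ℝ) T, HasDerivAt z (zdot t) t)
    (hgradH : ∀ t ∈ Icc (0:ℝ) T, ∀ w, HasGradZAt (H t) (gradH t w) w)
    (hincl : ∀ t ∈ Icc (0:ℝ) T, DissInclAt R (z t) (zdot t) (gradH t (z t)))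
    -- (i) positive 1-homogeneity of the dissipation in the rate
    (hhom : ∀ w : E × E, ∀ l : ℝ, 0 ≤ l → ∀ v : E × E, R w (l • v) = l * R w v)
    -- (ii) R depends only on the first component of the rate
    (hfirst : ∀ w : E × E, ∀ a b : E, R w (a, b) = R w (a, 0))
    -- (iii) partial time derivative of H and chain rule along the solution
    (hHt : ∀ t ∈ Icc (0:ℝ) T, ∀ w, HasDerivAt (fun s => H s w) (Ht t w) t)
    (hchain : ∀ t ∈ Icc (0:ℝ) T,
      HasDerivAt (fun s => H s (z s))
        (Ht t (z t) + innerZ (gradH t (z t)) (zdot t)) t)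
    (hchainInt : IntervalIntegrable
      (fun τ => Ht τ (z τ) + innerZ (gradH τ (z τ)) (zdot τ)) volume 0 T)
    -- (iv) integrability
    (hHtInt : IntervalIntegrable (fun τ => Ht τ (z τ)) volume 0 T)
    (hRInt : IntervalIntegrable (fun τ => R (z τ) (zdot τ)) volume 0 T) :
    ∀ t ∈ Icc (0:ℝ) T,
      H 0 (z 0) + ∫ τ in (0:ℝ)..t, Ht τ (z τ) =
        H t (z t) + ∫ τ in (0:ℝ)..t, R (z τ) (zdot τ) := by
  intro t ht
  have hsub : uIcc 0 t ⊆ uIcc 0 T := by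
    rw [uIcc_of_le ht.1, uIcc_of_le hT.le]
    exact Icc_subset_Icc_right ht.2
  have hmem : ∀ τ ∈ uIcc 0 t, τ ∈ Icc (0:ℝ) T := by
    rwa [uIcc_of_le hT.le] at hsub
  have hftc := integral_eq_sub_of_hasDerivAt (fun τ hτ => hchain τ (hmem τ hτ))
    (hchainInt.mono_set hsub)
  have hcongr : ∫ τ in (0:ℝ)..t, (Ht τ (z τ) + innerZ (gradH τ (z τ)) (zdot τ)) =
      ∫ τ in (0:ℝ)..t, (Ht τ (z τ) - R (z τ) (zdot τ)) :=
    integral_congr fun τ hτ => by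
      simp only [(hincl τ (hmem τ hτ)).innerZ_eq_neg (hRzero _) (hhom _), sub_eq_add_neg]
  rw [hcongr, intervalIntegral.integral_sub (hHtInt.mono_set hsub) (hRInt.mono_set hsub)] at hftc
  linarith
end

section
/- Characterization of solutions via test functions (Proposition 2.2 of the paper). Let T > 0, let z : ℝ → Z be differentiable at every t ∈ [0,T] with derivative ż(t), let H : ℝ → Z → ℝ be such that for each t ∈ [0,T] the map H(t,·) has a gradient ∇₂H(t,w) at every w ∈ Z, and let R : Z → Z → ℝ. Then the following are equivalent: (i) z satisfies the dissipative Hamiltonian inclusion at every t ∈ [0,T]; (ii) for every function f : Z → ℝ having a gradient ∇f(w) at every w ∈ Z and for every t ∈ [0,T]: R(z(t), ż(t) − X_f(z(t))) ≥ R(z(t), ż(t)) + ⟪∇f(z(t)), ż(t)⟫ − ω(X_f(z(t)), X_{H(t,·)}(z(t))). (Here ⟪∇f(z(t)), ż(t)⟫ is the derivative of t ↦ f(z(t)), and ω(X_f, X_{H(t,·)}) is the Poisson bracket {f, H(t,·)}.) -/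
open MeasureTheory intervalIntegral Set
open scoped RealInnerProductSpace

/-- The symplectic form against `-X_g` splits into the pairing with `g` and the Poisson bracket. -/
theorem sympl_sub_Xg_neg_Xg {E : Type*} [NormedAddCommGroup E] [InnerProductSpace ℝ E]
    (v g h : E × E) :
    sympl (v - Xg h) (-Xg g) = innerZ g v - sympl (Xg g) (Xg h) := by
  simp only [sympl, Xg, innerZ, Prod.fst_sub, Prod.snd_sub, Prod.fst_neg, Prod.snd_neg,
    inner_sub_left, inner_sub_right, inner_neg_left, inner_neg_right,
    real_inner_comm g.1 v.1, real_inner_comm g.1 h.2]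
  ring

/-- A linear functional `⟪g, ·⟫` has constant gradient `g`. -/
theorem hasGradZAt_innerZ {E : Type*} [NormedAddCommGroup E] [InnerProductSpace ℝ E]
    (g w : E × E) : HasGradZAt (innerZ g) g w :=
  (((innerSL ℝ g.1).comp (ContinuousLinearMap.fst ℝ E E)) +
    ((innerSL ℝ g.2).comp (ContinuousLinearMap.snd ℝ E E))).hasFDerivAt

/-- Characterization of solutions via test functions (Proposition 2.2). -/
theorem solution_characterization_via_test_functions
    {E : Type*} [NormedAddCommGroup E] [InnerProductSpace ℝ E]
    (T : ℝ) (hT : 0 < T)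
    (z zdot : ℝ → E × E)
    (H : ℝ → E × E → ℝ) (gradH : ℝ → E × E → E × E)
    (R : (E × E) → (E × E) → ℝ)
    (hderiv : ∀ t ∈ Icc (0:ℝ) T, HasDerivAt z (zdot t) t)
    (hgradH : ∀ t ∈ Icc (0:ℝ) T, ∀ w, HasGradZAt (H t) (gradH t w) w) :
    (∀ t ∈ Icc (0:ℝ) T, DissInclAt R (z t) (zdot t) (gradH t (z t)))
      ↔
    (∀ (f : E × E → ℝ) (gradf : E × E → E × E),
      (∀ w, HasGradZAt f (gradf w) w) →
      ∀ t ∈ Icc (0:ℝ) T,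
        R (z t) (zdot t - Xg (gradf (z t))) ≥
          R (z t) (zdot t) + innerZ (gradf (z t)) (zdot t)
            - sympl (Xg (gradf (z t))) (Xg (gradH t (z t)))) := by
  constructor
  · intro hincl f gradf _ t ht
    have := hincl t ht (-Xg (gradf (z t)))
    rwa [sympl_sub_Xg_neg_Xg, ← sub_eq_add_neg, ← add_sub_assoc] at this
  · intro htest t ht v
    have hv : -Xg (v.2, -v.1) = v := by simp [Xg]
    have := htest (innerZ (v.2, -v.1)) (fun _ => (v.2, -v.1)) (hasGradZAt_innerZ _) t ht
    rwa [add_sub_assoc, ← sympl_sub_Xg_neg_Xg, sub_eq_add_neg, hv] at this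
end

section
/- Lower bound on the dissipation along a weak solution (Proposition 2.4 of the paper). Let T > 0 and let z : ℝ → Z be differentiable at almost every t ∈ [0,T] with derivative ż(t), satisfying the dissipative Hamiltonian inclusion at almost every t ∈ [0,T] for a Hamiltonian H : ℝ → Z → ℝ and a dissipation function R : Z → Z → ℝ (so R(w,v) ≥ 0 and R(w,0) = 0 for all w,v). Assume the maps τ ↦ R(z(τ), ż(τ)) and τ ↦ ω(ż(τ), X_{H(τ,·)}(z(τ))) are interval-integrable on [0,T]. Then for every t ∈ [0,T] the dissipation η(t) := ∫₀ᵗ ω(ż(τ), X_{H(τ,·)}(z(τ))) dτ satisfies η(t) ≥ ∫₀ᵗ R(z(τ), ż(τ)) dτ ≥ 0. -/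
open MeasureTheory intervalIntegral Set
open scoped RealInnerProductSpace

/-- Testing the inclusion with `-zdot` bounds the dissipation by the symplectic pairing. -/
theorem DissInclAt.le_sympl {E : Type*} [NormedAddCommGroup E] [InnerProductSpace ℝ E]
    {R : (E × E) → (E × E) → ℝ} {zt zdot gradH : E × E}
    (h : DissInclAt R zt zdot gradH) (hR : R zt 0 = 0) :
    R zt zdot ≤ sympl zdot (Xg gradH) := by
  have h0 := h (-zdot)
  simp only [add_neg_cancel, hR, sympl, Prod.fst_sub, Prod.snd_sub, Prod.fst_neg, Prod.snd_neg,
    inner_sub_left, inner_sub_right, inner_neg_left, inner_neg_right] at h0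
  simp only [sympl]
  linarith [real_inner_comm zdot.1 (Xg gradH).2, real_inner_comm zdot.2 (Xg gradH).1]

/-- Lower bound on the dissipation along a weak solution (Proposition 2.4). -/
theorem dissipation_lower_bound
    {E : Type*} [NormedAddCommGroup E] [InnerProductSpace ℝ E]
    (T : ℝ) (hT : 0 < T)
    (z zdot : ℝ → E × E)
    (H : ℝ → E × E → ℝ) (gradH : ℝ → E × E → E × E)
    (R : (E × E) → (E × E) → ℝ)
    (hRnonneg : ∀ w v : E × E, 0 ≤ R w v)
    (hRzero : ∀ w : E × E, R w 0 = 0)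
    (hgradH : ∀ t ∈ Icc (0:ℝ) T, ∀ w, HasGradZAt (H t) (gradH t w) w)
    (hae : ∀ᵐ t ∂(volume : Measure ℝ), t ∈ Icc (0:ℝ) T →
      HasDerivAt z (zdot t) t ∧ DissInclAt R (z t) (zdot t) (gradH t (z t)))
    (hRInt : IntervalIntegrable (fun τ => R (z τ) (zdot τ)) volume 0 T)
    (hωInt : IntervalIntegrable
      (fun τ => sympl (zdot τ) (Xg (gradH τ (z τ)))) volume 0 T) :
    ∀ t ∈ Icc (0:ℝ) T,
      (∫ τ in (0:ℝ)..t, sympl (zdot τ) (Xg (gradH τ (z τ)))) ≥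
        (∫ τ in (0:ℝ)..t, R (z τ) (zdot τ)) ∧
      (∫ τ in (0:ℝ)..t, R (z τ) (zdot τ)) ≥ 0 := by
  intro t ht
  have hsub : uIcc 0 t ⊆ uIcc 0 T := by
    rw [uIcc_of_le ht.1, uIcc_of_le hT.le]
    exact Icc_subset_Icc_right ht.2
  refine ⟨integral_mono_ae_restrict ht.1 (hRInt.mono_set hsub) (hωInt.mono_set hsub) ?_,
    integral_nonneg ht.1 fun τ _ => hRnonneg _ _⟩
  filter_upwards [ae_restrict_of_ae hae, ae_restrict_mem measurableSet_Icc] with τ hτ hmem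
  exact (hτ ⟨hmem.1, hmem.2.trans ht.2⟩).2.le_sympl (hRzero _)
end

section
/- The non-dissipative Hamiltonian equation holds exactly along weak solutions (first step in the proof of Theorem 2.5 of the paper). Let z : ℝ → Z have derivative ż(t) at a time t, let H : ℝ → Z → ℝ be such that H(t,·) has a gradient ∇₂H(t, z(t)) at z(t), and let R : Z → Z → ℝ satisfy R(w,(a,b)) = R(w,(a,0)) for all w ∈ Z and a,b ∈ E (R depends only on the first component of the rate). If z satisfies the dissipative Hamiltonian inclusion at time t, then the first component of ż(t) equals the first component of X_{H(t,·)}(z(t)); that is, (ż(t)).1 = (∇₂H(t, z(t))).2. -/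
open MeasureTheory intervalIntegral Set
open scoped RealInnerProductSpace

/-- The non-dissipative Hamiltonian equation holds exactly along weak solutions. -/
theorem nondissipative_equation_along_weak_solutions
    {E : Type*} [NormedAddCommGroup E] [InnerProductSpace ℝ E]
    (z : ℝ → E × E) (zd : E × E) (t : ℝ)
    (H : ℝ → E × E → ℝ) (grad : E × E)
    (R : (E × E) → (E × E) → ℝ)
    (hderiv : HasDerivAt z zd t)
    (hgrad : HasGradZAt (H t) grad (z t))
    (hfirst : ∀ w : E × E, ∀ a b : E, R w (a, b) = R w (a, 0))
    (hincl : DissInclAt R (z t) zd grad) :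
    zd.1 = grad.2 := by
  have hR : R (z t) (zd + (0, zd.1 - grad.2)) = R (z t) zd := by
    obtain ⟨a, b⟩ := zd
    rw [Prod.mk_add_mk, add_zero, hfirst _ a (b + _), hfirst _ a b]
  have h := hincl (0, zd.1 - grad.2)
  rw [hR] at h
  simp only [sympl, Xg, Prod.fst_sub, inner_zero_left, sub_zero] at h
  exact sub_eq_zero.mp (real_inner_self_nonpos.mp (by linarith))
end

section
/- Pointwise energy identity for 1-homogeneous dissipation. Let z : ℝ → Z have derivative ż(t) at a time t, let H : ℝ → Z → ℝ be such that H(t,·) has a gradient ∇₂H(t, z(t)) at z(t), and let R : Z → Z → ℝ satisfy R(z(t), 0) = 0 and positive 1-homogeneity in the rate: R(z(t), λ•v) = λ·R(z(t), v) for all λ ≥ 0 and v ∈ Z. If z satisfies the dissipative Hamiltonian inclusion at time t, then ω(ż(t), X_{H(t,·)}(z(t))) = R(z(t), ż(t)). -/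
open MeasureTheory intervalIntegral Set
open scoped RealInnerProductSpace

theorem sympl_sub_self_left {E : Type*} [NormedAddCommGroup E] [InnerProductSpace ℝ E]
    (a b : E × E) : sympl (a - b) a = sympl a b := by
  simp only [sympl, Prod.fst_sub, Prod.snd_sub, inner_sub_left, inner_sub_right]
  rw [real_inner_comm a.2 b.1]
  ring

theorem sympl_neg_right {E : Type*} [NormedAddCommGroup E] [InnerProductSpace ℝ E]
    (a b : E × E) : sympl a (-b) = -sympl a b := by
  simp only [sympl, Prod.fst_neg, Prod.snd_neg, inner_neg_left, inner_neg_right]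
  ring

/-- Pointwise energy identity for 1-homogeneous dissipation. -/
theorem pointwise_energy_identity
    {E : Type*} [NormedAddCommGroup E] [InnerProductSpace ℝ E]
    (z : ℝ → E × E) (zd : E × E) (t : ℝ)
    (H : ℝ → E × E → ℝ) (grad : E × E)
    (R : (E × E) → (E × E) → ℝ)
    (hderiv : HasDerivAt z zd t)
    (hgrad : HasGradZAt (H t) grad (z t))
    (hRzero : R (z t) 0 = 0)
    (hhom : ∀ l : ℝ, 0 ≤ l → ∀ v : E × E, R (z t) (l • v) = l * R (z t) v)
    (hincl : DissInclAt R (z t) zd grad) :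
    sympl zd (Xg grad) = R (z t) zd := by
  have hdouble := hincl zd
  have hcancel := hincl (-zd)
  rw [← two_smul ℝ zd, hhom 2 zero_le_two, sympl_sub_self_left] at hdouble
  rw [add_neg_cancel, hRzero, sympl_neg_right, sympl_sub_self_left] at hcancel
  linarith
end

section
/- The dissipation along a solution of the Mielke-type system with inertia dominates the dissipation distance (Section 3 of the paper). Let E be a real Hilbert space, T > 0, and let q, p : ℝ → E be differentiable at every s ∈ [0,T] with derivatives q̇(s), ṗ(s). Let K : E → ℝ have a gradient ∇K(w) at every w ∈ E, let 𝓔 : ℝ → E → ℝ be such that each 𝓔(s,·) has a gradient ∇_q𝓔(s, w) at every w ∈ E, and let R : E → E → ℝ satisfy R(w,v) ≥ 0, R(w,0) = 0 and R(w, λ•v) = λ·R(w,v) for all λ ≥ 0, v, w ∈ E. Suppose that for every s ∈ [0,T]: q̇(s) = ∇K(p(s)), and for all u ∈ E, R(q(s), q̇(s) + u) ≥ R(q(s), q̇(s)) + ⟪−ṗ(s) − ∇_q𝓔(s, q(s)), u⟫; and assume the maps s ↦ R(q(s), q̇(s)) and s ↦ ⟪∇K(p(s)), ṗ(s)⟫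 + ⟪q̇(s), ∇_q𝓔(s, q(s))⟫ are interval-integrable on [0,T]. Then for every t ∈ (0,T], the dissipation η(t) := −∫₀ᵗ [⟪∇K(p(s)), ṗ(s)⟫ + ⟪q̇(s), ∇_q𝓔(s, q(s))⟫] ds satisfies η(t) ≥ ∫₀ᵗ R(q(s), q̇(s)) ds ≥ D(q(0), q(t)) ≥ 0, where D is the dissipation distance on E associated to R (the inequality against D being in the extended nonnegative reals). -/
open MeasureTheory intervalIntegral Set
open scoped RealInnerProductSpace

/-- The dissipation distance between the end points of a differentiable curve on `[0, t]` is at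
most the dissipation along the curve, when the dissipation function is positively homogeneous. -/
lemma dissDist_le_ofReal_integral {V : Type*} [NormedAddCommGroup V] [NormedSpace ℝ V]
    {R : V → V → ℝ} (hhom : ∀ w : V, ∀ l : ℝ, 0 ≤ l → ∀ v : V, R w (l • v) = l * R w v)
    {t : ℝ} (ht : 0 < t) {q qd : ℝ → V} (hq : ∀ s ∈ Icc (0:ℝ) t, HasDerivAt q (qd s) s)
    (hR : IntervalIntegrable (fun s => R (q s) (qd s)) volume 0 t) :
    dissDist R (q 0) (q t) ≤ ENNReal.ofReal (∫ s in (0:ℝ)..t, R (q s) (qd s)) := by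
  have hspeed : (fun s => R (q (t * s)) (t • qd (t * s))) =
      fun s => t * R (q (t * s)) (qd (t * s)) :=
    funext fun s => hhom _ t ht.le _
  refine sInf_le ⟨fun s => q (t * s), fun s => t • qd (t * s), by simp, by simp, ?_, ?_, ?_⟩
  · intro s hs
    have hmem : t * s ∈ Icc (0:ℝ) t :=
      ⟨mul_nonneg ht.le hs.1, mul_le_of_le_one_right ht.le hs.2⟩
    have hlin : HasDerivAt (fun s : ℝ => t * s) t s := by
      simpa using (hasDerivAt_id s).const_mul t
    exact (hq _ hmem).scomp s hlin
  · have hcomp := (hR.comp_mul_left (c := t)).const_mul t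
    rw [zero_div, div_self ht.ne'] at hcomp
    exact hspeed ▸ hcomp
  · have hsubst := mul_integral_comp_mul_left (a := 0) (b := 1)
      (f := fun s => R (q s) (qd s)) t
    rw [mul_zero, mul_one] at hsubst
    rw [hspeed, intervalIntegral.integral_const_mul, hsubst]

/-- The dissipation along a solution of the Mielke-type system with inertia
dominates the dissipation distance (Section 3). -/
theorem mielke_dissipation_dominates_dissipation_distance
    {E : Type*} [NormedAddCommGroup E] [InnerProductSpace ℝ E] [CompleteSpace E]
    (T : ℝ) (hT : 0 < T)
    (q p : ℝ → E) (qd pd : ℝ → E)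
    (K : E → ℝ) (gK : E → E)
    (En : ℝ → E → ℝ) (gE : ℝ → E → E)
    (R : E → E → ℝ)
    (hq : ∀ s ∈ Icc (0:ℝ) T, HasDerivAt q (qd s) s)
    (hp : ∀ s ∈ Icc (0:ℝ) T, HasDerivAt p (pd s) s)
    (hK : ∀ w : E, HasGradientAt K (gK w) w)
    (hE : ∀ s ∈ Icc (0:ℝ) T, ∀ w : E, HasGradientAt (En s) (gE s w) w)
    (hRnonneg : ∀ w v : E, 0 ≤ R w v)
    (hRzero : ∀ w : E, R w 0 = 0)
    (hhom : ∀ w : E, ∀ l : ℝ, 0 ≤ l → ∀ v : E, R w (l • v) = l * R w v)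
    -- the system (2.24) at every time of `[0,T]`
    (hk : ∀ s ∈ Icc (0:ℝ) T, qd s = gK (p s))
    (hfb : ∀ s ∈ Icc (0:ℝ) T, ∀ u : E,
      R (q s) (qd s + u) ≥ R (q s) (qd s) + ⟪-(pd s) - gE s (q s), u⟫)
    -- integrability
    (hRInt : IntervalIntegrable (fun s => R (q s) (qd s)) volume 0 T)
    (hpowInt : IntervalIntegrable
      (fun s => ⟪gK (p s), pd s⟫ + ⟪qd s, gE s (q s)⟫) volume 0 T) :
    ∀ t ∈ Ioc (0:ℝ) T,
      (-(∫ s in (0:ℝ)..t, (⟪gK (p s), pd s⟫ + ⟪qd s, gE s (q s)⟫)) ≥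
          ∫ s in (0:ℝ)..t, R (q s) (qd s)) ∧
      (ENNReal.ofReal (∫ s in (0:ℝ)..t, R (q s) (qd s)) ≥
          dissDist R (q 0) (q t)) ∧
      dissDist R (q 0) (q t) ≥ 0 := by
  rintro t ⟨ht0, htT⟩
  have hsub : uIcc (0:ℝ) t ⊆ uIcc 0 T := by
    rw [uIcc_of_le ht0.le, uIcc_of_le hT.le]
    exact Icc_subset_Icc_right htT
  refine ⟨?_, dissDist_le_ofReal_integral hhom ht0
    (fun s hs => hq s ⟨hs.1, hs.2.trans htT⟩) (hRInt.mono_set hsub), zero_le⟩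
  rw [ge_iff_le, ← intervalIntegral.integral_neg]
  refine integral_mono_on ht0.le (hRInt.mono_set hsub) (hpowInt.mono_set hsub).neg fun s hs => ?_
  have hsT : s ∈ Icc (0:ℝ) T := ⟨hs.1, hs.2.trans htT⟩
  have hforce := hfb s hsT (-(qd s))
  rw [add_neg_cancel, hRzero, inner_neg_right, inner_sub_left, inner_neg_left,
    real_inner_comm, real_inner_comm (qd s)] at hforce
  rw [← hk s hsT]
  linarith
end
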